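/- For every m > 0 there exist a real constant a and a constant C > 0 such that for all s ≥ 1: |r_m(s) − sinh(s + a)| ≤ C e^{−2s} and |r_m(s)² − sinh²(s + a) − (2m/3)/sinh(s + a)| ≤ C e^{−3s}. (This expresses, up to a normalizing shift of the radial coordinate, the expansions r = sinh(s)(1 + O(e^{−3s})) and g_m = ds² + sinh²(s) v_m(s) g₀ with v_m(s) = 1 + 2m/(3 sinh³ s) + O(e^{−5s}).) -/

import Mathlib

open MeasureTheory

/-- The arclength function `s_m(r) = ∫_{r₀}^{r} (1 + t² − 2m/t)^{−1/2} dt`, the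
`g_m`-distance from the coordinate sphere `S_r` to the boundary sphere `S_{r₀}` in the
Schwarzschild anti-de Sitter space of mass `m`. -/
noncomputable def sm (m r₀ r : ℝ) : ℝ :=
  ∫ t in Set.Ioc r₀ r, (Real.sqrt (1 + t ^ 2 - 2 * m / t))⁻¹

lemma p_eq {m r₀ t : ℝ} (hroot : r₀ ^ 3 + r₀ = 2 * m) (ht : 0 < t) :
    1 + t ^ 2 - 2 * m / t = (t - r₀) * (t ^ 2 + t * r₀ + r₀ ^ 2 + 1) / t := by
  rw [← hroot]; field_simp; ring

lemma p_pos {m r₀ t : ℝ} (hr₀ : 0 < r₀) (hroot : r₀ ^ 3 + r₀ = 2 * m) (ht : r₀ < t) :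
    0 < 1 + t ^ 2 - 2 * m / t := by
  have h0 : 0 < t := hr₀.trans ht
  rw [p_eq hroot h0]
  have := sub_pos.2 ht
  positivity

noncomputable def HH (r₀ t : ℝ) : ℝ := Real.arsinh (2 * Real.sqrt (t ^ 2 - r₀ * t))

noncomputable def HH' (r₀ t : ℝ) : ℝ :=
  (Real.sqrt (1 + (2 * Real.sqrt (t ^ 2 - r₀ * t)) ^ 2))⁻¹ *
    (2 * ((2 * t - r₀) / (2 * Real.sqrt (t ^ 2 - r₀ * t))))

lemma HH_cont (r₀ : ℝ) : Continuous (HH r₀) := by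
  unfold HH
  exact Real.continuous_arsinh.comp (by fun_prop)

lemma HH_deriv {r₀ t : ℝ} (hr₀ : 0 < r₀) (ht : r₀ < t) : HasDerivAt (HH r₀) (HH' r₀ t) t := by
  have h1 : HasDerivAt (fun t : ℝ => t ^ 2 - r₀ * t) (2 * t - r₀) t := by
    have := (hasDerivAt_pow 2 t).fun_sub ((hasDerivAt_id' t).const_mul r₀)
    simpa using this
  have h2 : t ^ 2 - r₀ * t ≠ 0 := by nlinarith
  exact ((h1.sqrt h2).const_mul 2).arsinh

lemma f_le {m r₀ t : ℝ} (hr₀ : 0 < r₀) (hroot : r₀ ^ 3 + r₀ = 2 * m) (ht : r₀ < t) :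
    (Real.sqrt (1 + t ^ 2 - 2 * m / t))⁻¹ ≤ HH' r₀ t := by
  have h0 : 0 < t := hr₀.trans ht
  have hd := sub_pos.2 ht
  have hp := p_pos hr₀ hroot ht
  have hw : 0 < t ^ 2 - r₀ * t := by nlinarith
  unfold HH'
  set w := Real.sqrt (t ^ 2 - r₀ * t) with hwdef
  have hw2 : w ^ 2 = t ^ 2 - r₀ * t := Real.sq_sqrt hw.le
  have hwp : 0 < w := Real.sqrt_pos.2 hw
  have hq : 0 < 1 + (2 * w) ^ 2 := by positivity
  have hP := Real.sqrt_pos.2 hp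
  have hQ := Real.sqrt_pos.2 hq
  have hP2 := Real.sq_sqrt hp.le
  have hQ2 := Real.sq_sqrt hq.le
  set P := Real.sqrt (1 + t ^ 2 - 2 * m / t)
  set Q := Real.sqrt (1 + (2 * w) ^ 2)
  have key : Q * w ≤ (2 * t - r₀) * P := by
    apply le_of_sq_le_sq _ (by nlinarith [mul_pos hd hP, mul_pos h0 hP])
    rw [mul_pow, mul_pow, hQ2, hP2, mul_pow, hw2, p_eq hroot h0, mul_div_assoc', le_div_iff₀ h0]
    have e1 : 0 ≤ (3 * t - r₀) * (t - r₀) := by nlinarith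
    have e2 : 0 ≤ 4 * r₀ * t ^ 3 + r₀ ^ 2 * t ^ 2 - 3 * r₀ ^ 3 * t + r₀ ^ 4 := by
      have : 0 ≤ r₀ * t * ((t - r₀) * (t + r₀)) := by positivity
      have : 0 < r₀ * t ^ 3 := by positivity
      nlinarith [sq_nonneg (r₀ * t), sq_nonneg (r₀ ^ 2)]
    have e3 := mul_nonneg hd.le (add_nonneg e1 e2)
    nlinarith [e3]
  have : Q⁻¹ * (2 * ((2 * t - r₀) / (2 * w))) = (2 * t - r₀) / (Q * w) := by
    field_simp
  rw [this, inv_eq_one_div, div_le_div_iff₀ hP (by positivity)]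
  linarith

lemma HH'_nonneg {r₀ t : ℝ} (hr₀ : 0 < r₀) (ht : r₀ < t) : 0 ≤ HH' r₀ t := by
  unfold HH'
  have : 0 ≤ 2 * t - r₀ := by linarith
  positivity

lemma HH'_int {r₀ r : ℝ} (hr₀ : 0 < r₀) : IntegrableOn (HH' r₀) (Set.Ioc r₀ r) :=
  intervalIntegral.integrableOn_deriv_of_nonneg (HH_cont r₀).continuousOn
    (fun _ hx => HH_deriv hr₀ hx.1) (fun _ hx => HH'_nonneg hr₀ hx.1)

lemma f_meas (m : ℝ) : Measurable (fun t : ℝ => (Real.sqrt (1 + t ^ 2 - 2 * m / t))⁻¹) := by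
  fun_prop

lemma f_int {m r₀ r : ℝ} (hr₀ : 0 < r₀) (hroot : r₀ ^ 3 + r₀ = 2 * m) :
    IntegrableOn (fun t : ℝ => (Real.sqrt (1 + t ^ 2 - 2 * m / t))⁻¹) (Set.Ioc r₀ r) := by
  refine Integrable.mono' (HH'_int hr₀) (f_meas m).aestronglyMeasurable ?_
  filter_upwards [ae_restrict_mem measurableSet_Ioc] with t ht
  rw [Real.norm_of_nonneg (by positivity)]
  exact f_le hr₀ hroot ht.1

lemma sm_le {m r₀ r : ℝ} (hr₀ : 0 < r₀) (hroot : r₀ ^ 3 + r₀ = 2 * m) (hr : r₀ ≤ r) :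
    sm m r₀ r ≤ Real.arsinh (2 * r) := by
  have h1 : sm m r₀ r ≤ ∫ t in Set.Ioc r₀ r, HH' r₀ t :=
    setIntegral_mono_on (f_int hr₀ hroot) (HH'_int hr₀) measurableSet_Ioc
      (fun t ht => f_le hr₀ hroot ht.1)
  have h2 : ∫ t in r₀..r, HH' r₀ t = HH r₀ r - HH r₀ r₀ :=
    intervalIntegral.integral_eq_sub_of_hasDerivAt_of_le hr (HH_cont r₀).continuousOn
      (fun x hx => HH_deriv hr₀ hx.1)
      ((intervalIntegrable_iff_integrableOn_Ioc_of_le hr).2 (HH'_int hr₀))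
  rw [intervalIntegral.integral_of_le hr] at h2
  have h3 : HH r₀ r₀ = 0 := by
    have : r₀ ^ 2 - r₀ * r₀ = 0 := by ring
    simp [HH, this]
  have h4 : HH r₀ r ≤ Real.arsinh (2 * r) := by
    unfold HH
    rw [Real.arsinh_le_arsinh]
    have : Real.sqrt (r ^ 2 - r₀ * r) ≤ r :=
      Real.sqrt_le_iff.2 ⟨by linarith, by nlinarith⟩
    linarith
  linarith

lemma sm_deriv {m r₀ r : ℝ} (hr₀ : 0 < r₀) (hroot : r₀ ^ 3 + r₀ = 2 * m) (hr : r₀ < r) :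
    HasDerivAt (sm m r₀) (Real.sqrt (1 + r ^ 2 - 2 * m / r))⁻¹ r := by
  have hp := p_pos hr₀ hroot hr
  have h0 : r ≠ 0 := (hr₀.trans hr).ne'
  have h := intervalIntegral.integral_hasDerivAt_right (a := r₀) (b := r)
    (f := fun t : ℝ => (Real.sqrt (1 + t ^ 2 - 2 * m / t))⁻¹)
    ((intervalIntegrable_iff_integrableOn_Ioc_of_le hr.le).2 (f_int hr₀ hroot))
    ((f_meas m).stronglyMeasurable.stronglyMeasurableAtFilter)
    (by
      have : Real.sqrt (1 + r ^ 2 - 2 * m / r) ≠ 0 := (Real.sqrt_pos.2 hp).ne'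
      fun_prop (disch := assumption))
  refine h.congr_of_eventuallyEq ?_
  filter_upwards [lt_mem_nhds hr] with x hx
  rw [intervalIntegral.integral_of_le hx.le, sm]

/-- `2 sinh x ≤ sinh (x + log 2)`. -/
lemma arsinh_two (r : ℝ) : Real.arsinh (2 * r) ≤ Real.arsinh r + Real.log 2 := by
  rw [← Real.sinh_le_sinh, Real.sinh_arsinh]
  have h : r = Real.sinh (Real.arsinh r) := (Real.sinh_arsinh r).symm
  set x := Real.arsinh r
  rw [h, Real.sinh_eq, Real.sinh_eq, neg_add, Real.exp_add, Real.exp_add, Real.exp_neg (Real.log 2),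
    Real.exp_log (by norm_num)]
  have := Real.exp_pos (-x)
  linarith

lemma fg_bound {m t : ℝ} (hm : 0 < m) (h1 : 1 ≤ t) (h2 : 2 * m ≤ t) :
    let f := (Real.sqrt (1 + t ^ 2 - 2 * m / t))⁻¹
    let g := (Real.sqrt (1 + t ^ 2))⁻¹
    f - g ≤ m / t ^ 4 ∧ m / t ^ 4 - 3 * m / 2 / t ^ 6 ≤ f - g ∧ g ≤ f := by
  intro f g
  have h0 : 0 < t := by linarith
  have hd : 2 * m / t ≤ 1 := (div_le_one h0).2 h2
  have hd0 : 0 < 2 * m / t := by positivity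
  have hp : t ^ 2 ≤ 1 + t ^ 2 - 2 * m / t := by linarith
  have hP : t ≤ Real.sqrt (1 + t ^ 2 - 2 * m / t) := Real.le_sqrt_of_sq_le hp
  have hQ : Real.sqrt (1 + t ^ 2) ≤ t + 1 / (2 * t) := by
    refine Real.sqrt_le_iff.2 ⟨by positivity, ?_⟩
    have : (t + 1 / (2 * t)) ^ 2 = t ^ 2 + 1 + (1 / (2 * t)) ^ 2 := by field_simp; ring
    rw [this]; nlinarith [sq_nonneg (1 / (2 * t))]
  have hPQ : Real.sqrt (1 + t ^ 2 - 2 * m / t) ≤ Real.sqrt (1 + t ^ 2) :=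
    Real.sqrt_le_sqrt (by linarith)
  have hP2 := Real.sq_sqrt (show 0 ≤ 1 + t ^ 2 - 2 * m / t by nlinarith)
  have hQ2 := Real.sq_sqrt (show 0 ≤ 1 + t ^ 2 by positivity)
  set P := Real.sqrt (1 + t ^ 2 - 2 * m / t)
  set Q := Real.sqrt (1 + t ^ 2)
  have hP0 : 0 < P := by linarith
  have hQ0 : 0 < Q := by linarith
  have hQt : t ≤ Q := by linarith
  have hfg : f - g = 2 * m / (t * (P * Q * (P + Q))) := by
    have e : (Q - P) * (Q + P) * t = 2 * m := by
      have : (Q - P) * (Q + P) = 2 * m / t := by linarith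
      rw [this]; field_simp
    show P⁻¹ - Q⁻¹ = _
    rw [← e]; field_simp; ring
  have hWlo : 2 * t ^ 3 ≤ P * Q * (P + Q) := by
    calc 2 * t ^ 3 = t * t * (t + t) := by ring
      _ ≤ _ := by gcongr
  have hWhi : P * Q * (P + Q) ≤ 2 * (t + 1 / (2 * t)) ^ 3 := by
    have : P ≤ t + 1 / (2 * t) := by linarith
    calc P * Q * (P + Q) ≤ (t + 1 / (2 * t)) * (t + 1 / (2 * t)) *
          ((t + 1 / (2 * t)) + (t + 1 / (2 * t))) := by gcongr
      _ = _ := by ring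
  refine ⟨?_, ?_, ?_⟩
  · rw [hfg]
    calc _ ≤ 2 * m / (t * (2 * t ^ 3)) := by gcongr
      _ = _ := by field_simp
  · rw [hfg]
    calc _ ≤ 2 * m / (t * (2 * (t + 1 / (2 * t)) ^ 3)) := by
          have e1 : m / t ^ 4 - 3 * m / 2 / t ^ 6 = m * (t ^ 2 - 3 / 2) / t ^ 6 := by
            field_simp
          have e2 : 2 * m / (t * (2 * (t + 1 / (2 * t)) ^ 3)) =
              m * t ^ 2 / (t ^ 2 + 1 / 2) ^ 3 := by
            field_simp
          rw [e1, e2, div_le_div_iff₀ (by positivity) (by positivity)]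
          set x := t ^ 2
          have hx : 0 < x := by positivity
          have e3 : t ^ 6 = x ^ 3 := by simp only [x]; ring
          rw [e3]
          have : (x - 3 / 2) * (x + 1 / 2) ^ 3 ≤ x * x ^ 3 := by
            nlinarith [sq_nonneg x]
          nlinarith
      _ ≤ _ := by gcongr
  · have : 0 ≤ f - g := by rw [hfg]; positivity
    linarith

lemma exists_shift {m r₀ R : ℝ} (hm : 0 < m) (hr₀ : 0 < r₀) (hroot : r₀ ^ 3 + r₀ = 2 * m)
    (hR1 : 1 ≤ R) (hR2 : 2 * m ≤ R) (hR3 : r₀ < R) :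
    ∃ a : ℝ, -Real.log 2 ≤ a ∧ ∀ r, R ≤ r →
      Real.arsinh r - sm m r₀ r - a ≤ m / (3 * r ^ 3) ∧
      m / (3 * r ^ 3) - 3 * m / 10 / r ^ 5 ≤ Real.arsinh r - sm m r₀ r - a := by
  set D : ℝ → ℝ := fun r => Real.arsinh r - sm m r₀ r with hD
  have hDd : ∀ r, R ≤ r → HasDerivAt D ((Real.sqrt (1 + r ^ 2))⁻¹ -
      (Real.sqrt (1 + r ^ 2 - 2 * m / r))⁻¹) r := fun r hr =>
    (Real.hasDerivAt_arsinh r).sub (sm_deriv hr₀ hroot (hR3.trans_le hr))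
  have hU : ∀ r, R ≤ r → HasDerivAt (fun r : ℝ => m / (3 * r ^ 3)) (-(m / r ^ 4)) r := by
    intro r hr
    have h0 : r ≠ 0 := by linarith
    have := ((hasDerivAt_pow 3 r).const_mul 3).fun_inv (by positivity) |>.const_mul m
    simp only [div_eq_mul_inv]
    refine this.congr_deriv ?_
    push_cast
    field_simp
    try norm_num
  have hV : ∀ r, R ≤ r → HasDerivAt (fun r : ℝ => 3 * m / 10 / r ^ 5) (-(3 * m / 2 / r ^ 6)) r := by
    intro r hr
    have h0 : r ≠ 0 := by linarith
    have := (hasDerivAt_pow 5 r).fun_inv (by positivity) |>.const_mul (3 * m / 10)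
    simp only [div_eq_mul_inv] at this ⊢
    refine this.congr_deriv ?_
    push_cast
    field_simp
    try norm_num
  have hb : ∀ r, R ≤ r → _ := fun r hr => fg_bound hm (hR1.trans hr) (hR2.trans hr)
  have hint : ∀ r, r ∈ interior (Set.Ici R) → R ≤ r := fun r hr => interior_subset hr
  have hDanti : AntitoneOn D (Set.Ici R) := by
    refine antitoneOn_of_hasDerivWithinAt_nonpos (convex_Ici R)
      (fun x hx => (hDd x hx).continuousAt.continuousWithinAt)
      (fun x hx => (hDd x (hint x hx)).hasDerivWithinAt) (fun x hx => ?_)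
    have := (hb x (hint x hx)).2.2
    linarith
  have hP0 : MonotoneOn (fun r => D r - m / (3 * r ^ 3)) (Set.Ici R) := by
    refine monotoneOn_of_hasDerivWithinAt_nonneg (convex_Ici R)
      (fun x hx => ((hDd x hx).fun_sub (hU x hx)).continuousAt.continuousWithinAt)
      (fun x hx => ((hDd x (hint x hx)).fun_sub (hU x (hint x hx))).hasDerivWithinAt)
      (fun x hx => ?_)
    have := (hb x (hint x hx)).1
    linarith
  have hP1 : AntitoneOn (fun r => D r - m / (3 * r ^ 3) + 3 * m / 10 / r ^ 5) (Set.Ici R) := by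
    refine antitoneOn_of_hasDerivWithinAt_nonpos (convex_Ici R)
      (fun x hx => (((hDd x hx).fun_sub (hU x hx)).fun_add
        (hV x hx)).continuousAt.continuousWithinAt)
      (fun x hx => (((hDd x (hint x hx)).fun_sub (hU x (hint x hx))).fun_add
        (hV x (hint x hx))).hasDerivWithinAt)
      (fun x hx => ?_)
    have := (hb x (hint x hx)).2.1
    linarith
  have hlow : ∀ r, R ≤ r → -Real.log 2 ≤ D r := by
    intro r hr
    have h1 := sm_le hr₀ hroot (hR3.le.trans hr)
    have h2 := arsinh_two r
    simp only [hD]; linarith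
  have hne : (D '' Set.Ici R).Nonempty := ⟨D R, R, Set.self_mem_Ici, rfl⟩
  have hbdd : BddBelow (D '' Set.Ici R) := ⟨-Real.log 2, by rintro _ ⟨r, hr, rfl⟩; exact hlow r hr⟩
  refine ⟨sInf (D '' Set.Ici R), le_csInf hne (by rintro _ ⟨r, hr, rfl⟩; exact hlow r hr), ?_⟩
  intro r hr
  have hr0 : 0 < r := by linarith
  constructor
  · have : D r - m / (3 * r ^ 3) ≤ sInf (D '' Set.Ici R) := by
      refine le_csInf hne ?_
      rintro _ ⟨x, hx, rfl⟩
      rcases le_total r x with h | h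
      · have h1 := hP0 (show r ∈ Set.Ici R from hr) hx h
        have hx0 : 0 < x := by linarith
        have h2 : 0 < m / (3 * x ^ 3) := by positivity
        simp only at h1
        linarith
      · have h1 := hDanti hx (show r ∈ Set.Ici R from hr) h
        have h2 : 0 < m / (3 * r ^ 3) := by positivity
        linarith
    linarith
  · have key : sInf (D '' Set.Ici R) ≤ D r - m / (3 * r ^ 3) + 3 * m / 10 / r ^ 5 + 0 := by
      have ht : Filter.Tendsto (fun x : ℝ => D r - m / (3 * r ^ 3) + 3 * m / 10 / r ^ 5 +
          m / (3 * x ^ 3)) Filter.atTop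
          (nhds (D r - m / (3 * r ^ 3) + 3 * m / 10 / r ^ 5 + 0)) := by
        refine tendsto_const_nhds.add (Filter.Tendsto.const_div_atTop ?_ m)
        exact (Filter.tendsto_pow_atTop (by norm_num)).const_mul_atTop (by norm_num)
      refine ge_of_tendsto ht ?_
      filter_upwards [Filter.eventually_ge_atTop r] with x hx
      have hxR : R ≤ x := hr.trans hx
      have h1 := hP1 (show r ∈ Set.Ici R from hr) (show x ∈ Set.Ici R from hxR) hx
      have h2 : sInf (D '' Set.Ici R) ≤ D x := csInf_le hbdd ⟨x, hxR, rfl⟩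
      have hx0 : 0 < x := by linarith
      have h3 : 0 < 3 * m / 10 / x ^ 5 := by positivity
      simp only at h1
      linarith
    linarith

lemma sinh_le_mul_cosh {x : ℝ} (hx : 0 ≤ x) : Real.sinh x ≤ x * Real.cosh x := by
  have hd : ∀ y : ℝ, HasDerivAt (fun y => y * Real.cosh y - Real.sinh y)
      (1 * Real.cosh y + y * Real.sinh y - Real.cosh y) y := fun y =>
    ((hasDerivAt_id' y).fun_mul (Real.hasDerivAt_cosh y)).fun_sub (Real.hasDerivAt_sinh y)
  have hmono : MonotoneOn (fun y => y * Real.cosh y - Real.sinh y) (Set.Ici 0) := by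
    refine monotoneOn_of_hasDerivWithinAt_nonneg (convex_Ici 0)
      (fun y _ => (hd y).continuousAt.continuousWithinAt)
      (fun y _ => (hd y).hasDerivWithinAt) (fun y hy => ?_)
    have hy0 : 0 ≤ y := interior_subset hy
    have := mul_nonneg hy0 (Real.sinh_nonneg_iff.2 hy0)
    linarith
  have := hmono Set.self_mem_Ici (show x ∈ Set.Ici 0 from hx) hx
  simp at this
  linarith

set_option maxHeartbeats 1000000 in
/-- Pure estimate: the expansion in terms of `r`. -/
lemma expansion {m r E : ℝ} (hm : 0 < m) (h1 : 1 ≤ r) (h2 : 2 * m ≤ r)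
    (hE1 : E ≤ m / (3 * r ^ 3)) (hE2 : m / (3 * r ^ 3) - 3 * m / 10 / r ^ 5 ≤ E) :
    let σ := Real.sinh (Real.arsinh r - E)
    |r - σ| ≤ (10 * m) / r ^ 2 ∧
    |r ^ 2 - σ ^ 2 - (2 * m / 3) / σ| ≤ (10 * m + 200 * m ^ 2) / r ^ 3 := by
  intro σ
  have h0 : 0 < r := by linarith
  -- work with `u = 1 / r`
  obtain ⟨u, hu⟩ : ∃ u, u = 1 / r := ⟨_, rfl⟩
  have hu0 : 0 < u := by rw [hu]; positivity
  have hur : u * r = 1 := by rw [hu]; field_simp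
  have hu1 : u ≤ 1 := by rw [hu]; exact (div_le_one h0).2 h1
  have hmu : m * u ≤ 1 / 2 := by nlinarith
  have k1 : m / (3 * r ^ 3) = m * u ^ 3 / 3 := by rw [hu]; field_simp
  have k2 : 3 * m / 10 / r ^ 5 = 3 * m / 10 * u ^ 5 := by rw [hu]; field_simp
  rw [k1] at hE1 hE2; rw [k2] at hE2
  have hu5 : u ^ 5 ≤ u ^ 3 := pow_le_pow_of_le_one hu0.le hu1 (by norm_num)
  have hE0 : 0 ≤ E := by nlinarith [mul_pos hm (pow_pos hu0 3)]
  have hmu3 : m * u ^ 3 ≤ u ^ 2 / 2 := by nlinarith [pow_pos hu0 2]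
  have hEu : E ≤ u ^ 2 / 6 := by linarith
  have hu2 : u ^ 2 ≤ 1 := pow_le_one₀ hu0.le hu1
  have hE6 : E ≤ 1 / 6 := by linarith
  have hc1 : 1 ≤ Real.cosh E := Real.one_le_cosh E
  have hs1 : E ≤ Real.sinh E := Real.self_le_sinh_iff.2 hE0
  have hc2 : Real.cosh E ≤ 1 + E ^ 2 := by
    have e1 := Real.cosh_le_exp_half_sq E
    have e2 := Real.abs_exp_sub_one_sub_id_le (x := E ^ 2 / 2) (by
      rw [abs_of_nonneg (by positivity)]; nlinarith)
    have e3 := (abs_le.1 e2).2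
    have e4 : E ^ 2 ≤ 1 := by nlinarith
    nlinarith [mul_nonneg (sq_nonneg E) (sub_nonneg.2 e4)]
  have hs2 : Real.sinh E ≤ E * (1 + E ^ 2) := by
    have : Real.sinh E ≤ E * Real.cosh E := sinh_le_mul_cosh hE0
    have := mul_le_mul_of_nonneg_left hc2 hE0
    linarith
  have hσ : σ = r * Real.cosh E - Real.sqrt (1 + r ^ 2) * Real.sinh E := by
    simp only [σ]
    rw [Real.sinh_sub, Real.sinh_arsinh, Real.cosh_arsinh]
  have hQ1 : r ≤ Real.sqrt (1 + r ^ 2) := Real.le_sqrt_of_sq_le (by linarith)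
  have hQ2 : Real.sqrt (1 + r ^ 2) ≤ r + u / 2 := by
    refine Real.sqrt_le_iff.2 ⟨by positivity, ?_⟩
    nlinarith [sq_nonneg u]
  set Q := Real.sqrt (1 + r ^ 2)
  set S := Real.sinh E
  set K := Real.cosh E
  clear_value σ
  obtain ⟨d, hd⟩ : ∃ d, d = r - σ := ⟨_, rfl⟩
  have hdQ : d = Q * S - r * (K - 1) := by rw [hd, hσ]; ring
  have hS0 : 0 ≤ S := by linarith
  have hm4 : 0 < m * u ^ 4 := by positivity
  have hu4 : m * u ^ 4 ≤ m * u ^ 2 := by nlinarith [mul_pos hm (pow_pos hu0 2)]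
  -- bounds of the `E` terms
  have hrE1 : r * E ≤ m * u ^ 2 / 3 := by
    calc r * E ≤ r * (m * u ^ 3 / 3) := by gcongr
      _ = (u * r) * (m * u ^ 2 / 3) := by ring
      _ = _ := by rw [hur, one_mul]
  have hrE2 : m * u ^ 2 / 3 - 3 * m / 10 * u ^ 4 ≤ r * E := by
    calc _ = (u * r) * (m * u ^ 2 / 3 - 3 * m / 10 * u ^ 4) := by rw [hur, one_mul]
      _ = r * (m * u ^ 3 / 3 - 3 * m / 10 * u ^ 5) := by ring
      _ ≤ _ := by gcongr
  have hrEE : r * E ^ 2 ≤ m * u ^ 4 := by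
    have : r * E * E ≤ m * u ^ 2 / 3 * (u ^ 2 / 6) := by gcongr
    have e1 : r * E ^ 2 = r * E * E := by ring
    have e2 : m * u ^ 2 / 3 * (u ^ 2 / 6) = m * u ^ 4 / 18 := by ring
    linarith
  have hup : d ≤ m * u ^ 2 / 3 + m * u ^ 4 := by
    have a1 : Q * S ≤ (r + u / 2) * (E * (1 + E ^ 2)) := by gcongr
    have a2 : (r + u / 2) * (E * (1 + E ^ 2)) = r * E + r * E ^ 2 * E + u * E / 2 * (1 + E ^ 2) := by
      ring
    have a3 : r * E ^ 2 * E ≤ m * u ^ 4 * (1 / 6) := by gcongr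
    have a4 : u * E ≤ m * u ^ 4 / 3 := by
      calc u * E ≤ u * (m * u ^ 3 / 3) := by gcongr
        _ = _ := by ring
    have a5 : u * E / 2 * (1 + E ^ 2) ≤ (m * u ^ 4 / 3) / 2 * (1 + 1) := by
      have : E ^ 2 ≤ 1 := pow_le_one₀ hE0 (by linarith)
      gcongr
    have a6 : 0 ≤ r * (K - 1) := mul_nonneg h0.le (by linarith)
    linarith
  have hlo : m * u ^ 2 / 3 - 2 * (m * u ^ 4) ≤ d := by
    have a1 : r * E ≤ Q * S := by gcongr
    have a2 : r * (K - 1) ≤ r * E ^ 2 := by gcongr; linarith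
    linarith
  have hm2 : 0 < m * u ^ 2 := by positivity
  have hdabs : |d| ≤ 2 * (m * u ^ 2) := abs_le.2 ⟨by linarith, by linarith⟩
  have e2 : (10 * m) / r ^ 2 = 10 * (m * u ^ 2) := by rw [hu]; field_simp
  have e3 : (10 * m + 200 * m ^ 2) / r ^ 3 = (10 * m + 200 * m ^ 2) * u ^ 3 := by
    rw [hu]; field_simp
  rw [e2, e3, ← hd]
  refine ⟨by linarith, ?_⟩
  have hdr : d ≤ 2 / 3 * r := by
    have : m * u * u ≤ 1 / 2 * 1 := by gcongr
    have e : m * u * u = m * u ^ 2 := by ring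
    linarith
  have hσr : r / 3 ≤ σ := by linarith
  have hσ0 : 0 < σ := by linarith
  have hid : r ^ 2 - σ ^ 2 - (2 * m / 3) / σ =
      2 * r * (d - m * u ^ 2 / 3) - d ^ 2 - 2 * m / 3 * (d * u / σ) := by
    have hσd : r = σ + d := by linarith
    have : 2 * m / 3 / σ = 2 * m / 3 * (u * r) / σ := by rw [hur, mul_one]
    have b : r * (m * u ^ 2 / 3) = (u * r) * (m * u) / 3 := by ring
    have c : 2 * m / 3 / σ = 2 * m / 3 * u + 2 * m / 3 * (d * u / σ) := by
      rw [this, hσd]; field_simp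
    rw [c, mul_sub, show 2 * r * (m * u ^ 2 / 3) = 2 * ((u * r) * (m * u) / 3) by ring, hur]
    rw [hσd]; ring
  have t1 : |2 * r * (d - m * u ^ 2 / 3)| ≤ 4 * m * u ^ 3 := by
    rw [abs_mul, abs_of_pos (by positivity : 0 < 2 * r)]
    have : |d - m * u ^ 2 / 3| ≤ 2 * (m * u ^ 4) := abs_le.2 ⟨by linarith, by linarith⟩
    calc _ ≤ 2 * r * (2 * (m * u ^ 4)) := by gcongr
      _ = (u * r) * (4 * m * u ^ 3) := by ring
      _ = _ := by rw [hur, one_mul]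
  have t2 : |d ^ 2| ≤ 4 * m ^ 2 * u ^ 3 := by
    rw [abs_pow]
    calc |d| ^ 2 ≤ (2 * (m * u ^ 2)) ^ 2 := by gcongr
      _ = 4 * m ^ 2 * u ^ 3 * u := by ring
      _ ≤ 4 * m ^ 2 * u ^ 3 * 1 := by gcongr
      _ = _ := by ring
  have t3 : |2 * m / 3 * (d * u / σ)| ≤ 4 * m ^ 2 * u ^ 3 := by
    rw [abs_mul, abs_of_pos (by positivity : 0 < 2 * m / 3), abs_div, abs_mul, abs_of_pos hu0,
      abs_of_pos hσ0]
    calc _ ≤ 2 * m / 3 * (2 * (m * u ^ 2) * u / (r / 3)) := by gcongr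
      _ = 4 * m ^ 2 * u ^ 3 * (1 / r) := by field_simp; norm_num
      _ ≤ 4 * m ^ 2 * u ^ 3 * 1 := by rw [← hu]; gcongr
      _ = _ := by ring
  rw [hid]
  have hpos : 0 < m * u ^ 3 := by positivity
  have hpos2 : 0 < m ^ 2 * u ^ 3 := by positivity
  refine (abs_sub _ _).trans ?_
  have := abs_sub (2 * r * (d - m * u ^ 2 / 3)) (d ^ 2)
  linarith

/-- For every `m > 0` there exist a real constant `a` and a constant
`C > 0` such that for all `s ≥ 1`: `|r_m(s) − sinh(s + a)| ≤ C e^{−2s}` and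
`|r_m(s)² − sinh²(s + a) − (2m/3)/sinh(s + a)| ≤ C e^{−3s}`.  (This expresses, up to a
normalizing shift of the radial coordinate, the expansions `r = sinh(s)(1 + O(e^{−3s}))`
and `g_m = ds² + sinh²(s) v_m(s) g₀` with `v_m(s) = 1 + 2m/(3 sinh³ s) + O(e^{−5s})`.)
Here `r₀` is the unique positive real with `r₀³ + r₀ = 2m` and `r_m` is the inverse of
`s_m`, expressed by the hypotheses `hinv₁`, `hinv₂`. -/
theorem penrose_stmt10 (m r₀ : ℝ) (hm : 0 < m) (hr₀ : 0 < r₀)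
    (hroot : r₀ ^ 3 + r₀ = 2 * m) (rm : ℝ → ℝ)
    (hinv₁ : ∀ r : ℝ, r₀ ≤ r → rm (sm m r₀ r) = r)
    (hinv₂ : ∀ s : ℝ, 0 ≤ s → r₀ ≤ rm s ∧ sm m r₀ (rm s) = s) :
    ∃ a C : ℝ, 0 < C ∧ ∀ s : ℝ, 1 ≤ s →
      |rm s - Real.sinh (s + a)| ≤ C * Real.exp (-2 * s) ∧
      |(rm s) ^ 2 - (Real.sinh (s + a)) ^ 2 - (2 * m / 3) / Real.sinh (s + a)| ≤
        C * Real.exp (-3 * s) := by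
  obtain ⟨R, hR⟩ : ∃ R, R = max 1 (max (2 * m) (r₀ + 1)) := ⟨_, rfl⟩
  have hR1 : 1 ≤ R := hR ▸ le_max_left _ _
  have hR2 : 2 * m ≤ R := hR ▸ (le_max_left _ _).trans (le_max_right _ _)
  have hR3 : r₀ < R := by
    have : r₀ + 1 ≤ R := hR ▸ (le_max_right _ _).trans (le_max_right _ _)
    linarith
  obtain ⟨a, ha, hexp⟩ := exists_shift hm hr₀ hroot hR1 hR2 hR3
  obtain ⟨M, hM⟩ : ∃ M, M = Real.arsinh (2 * R) := ⟨_, rfl⟩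
  have hlog : Real.log 2 < 1 := by
    have := Real.log_two_lt_d9
    linarith
  obtain ⟨δ, hδ⟩ : ∃ δ, δ = Real.sinh (1 - Real.log 2) := ⟨_, rfl⟩
  have hδ0 : 0 < δ := by rw [hδ]; exact Real.sinh_pos_iff.2 (by linarith)
  obtain ⟨B, hB⟩ : ∃ B, B = |Real.sinh (M + a)| := ⟨_, rfl⟩
  have hB0 : 0 ≤ B := hB ▸ abs_nonneg _
  obtain ⟨C₁, hC₁⟩ : ∃ C₁, C₁ = (10 * m + 200 * m ^ 2) * 125 := ⟨_, rfl⟩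
  obtain ⟨C₂, hC₂⟩ : ∃ C₂, C₂ = (R + B + R ^ 2 + B ^ 2 + (2 * m / 3) / δ) := ⟨_, rfl⟩
  have hC₁0 : 0 < C₁ := by rw [hC₁]; positivity
  have hC₂0 : 0 < C₂ := by rw [hC₂]; positivity
  have hq : 0 < (2 * m / 3) / δ := by positivity
  refine ⟨a, C₁ + C₂ * Real.exp (3 * M), by positivity, fun s hs => ?_⟩
  obtain ⟨hr, hsm⟩ := hinv₂ s (by linarith)
  set r := rm s
  have hr0 : 0 < r := by linarith
  have hsle : s ≤ Real.arsinh (2 * r) := hsm ▸ sm_le hr₀ hroot hr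
  have hσδ : δ ≤ Real.sinh (s + a) := by
    rw [hδ, Real.sinh_le_sinh]; linarith
  have hX2 := Real.exp_pos (-2 * s)
  have hX3 := Real.exp_pos (-3 * s)
  rcases le_total R r with h | h
  · obtain ⟨e1, e2⟩ := hexp r h
    have hr1 : 1 ≤ r := hR1.trans h
    obtain ⟨b1, b2⟩ := expansion hm hr1 (hR2.trans h) e1 e2
    have hE : Real.arsinh r - (Real.arsinh r - sm m r₀ r - a) = s + a := by rw [hsm]; ring
    rw [hE] at b1 b2
    have hexp5 : Real.exp s ≤ 5 * r := by
      have h1 : Real.sinh s ≤ 2 * r := by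
        have := Real.sinh_le_sinh.2 hsle
        rwa [Real.sinh_arsinh] at this
      rw [Real.sinh_eq] at h1
      have h2 : Real.exp (-s) ≤ 1 := Real.exp_le_one_iff.2 (by linarith)
      linarith
    have hy : 1 / r ≤ 5 * Real.exp (-s) := by
      rw [Real.exp_neg, div_le_iff₀ hr0]
      have := Real.exp_pos s
      field_simp
      linarith
    have hy0 : 0 < 1 / r := by positivity
    have p2 : 1 / r ^ 2 ≤ 25 * Real.exp (-2 * s) := by
      calc 1 / r ^ 2 = (1 / r) ^ 2 := by rw [div_pow, one_pow]
        _ ≤ (5 * Real.exp (-s)) ^ 2 := by gcongr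
        _ = 25 * Real.exp (-2 * s) := by
          rw [mul_pow, ← Real.exp_nat_mul]; norm_num
    have p3 : 1 / r ^ 3 ≤ 125 * Real.exp (-3 * s) := by
      calc 1 / r ^ 3 = (1 / r) ^ 3 := by rw [div_pow, one_pow]
        _ ≤ (5 * Real.exp (-s)) ^ 3 := by gcongr
        _ = 125 * Real.exp (-3 * s) := by
          rw [mul_pow, ← Real.exp_nat_mul]; norm_num
    have hle : C₁ ≤ C₁ + C₂ * Real.exp (3 * M) := by
      have := mul_pos hC₂0 (Real.exp_pos (3 * M))
      linarith
    constructor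
    · calc _ ≤ 10 * m / r ^ 2 := b1
        _ = 10 * m * (1 / r ^ 2) := by ring
        _ ≤ 10 * m * (25 * Real.exp (-2 * s)) := by gcongr
        _ = (10 * m * 25) * Real.exp (-2 * s) := by ring
        _ ≤ C₁ * Real.exp (-2 * s) := by
          gcongr
          rw [hC₁]; nlinarith
        _ ≤ _ := by gcongr
    · calc _ ≤ (10 * m + 200 * m ^ 2) / r ^ 3 := b2
        _ = (10 * m + 200 * m ^ 2) * (1 / r ^ 3) := by ring
        _ ≤ (10 * m + 200 * m ^ 2) * (125 * Real.exp (-3 * s)) := by gcongr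
        _ = C₁ * Real.exp (-3 * s) := by rw [hC₁]; ring
        _ ≤ _ := by gcongr
  · have hsM : s ≤ M := by
      rw [hM]
      exact hsle.trans (Real.arsinh_le_arsinh.2 (by linarith))
    have hσB : Real.sinh (s + a) ≤ B := by
      rw [hB]
      exact (Real.sinh_le_sinh.2 (by linarith)).trans (le_abs_self _)
    set σ := Real.sinh (s + a)
    have hσ0 : 0 < σ := by linarith
    have c1 : |r - σ| ≤ C₂ := by
      have : 0 ≤ R ^ 2 + B ^ 2 := by positivity
      rw [abs_le]; constructor <;> linarith
    have c2 : |r ^ 2 - σ ^ 2 - (2 * m / 3) / σ| ≤ C₂ := by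
      have q1 : (2 * m / 3) / σ ≤ (2 * m / 3) / δ := by gcongr
      have q0 : 0 < (2 * m / 3) / σ := by positivity
      have q2 : r ^ 2 ≤ R ^ 2 := by gcongr
      have q3 : σ ^ 2 ≤ B ^ 2 := by gcongr
      have q4 : 0 < r ^ 2 := by positivity
      have q5 : 0 < σ ^ 2 := by positivity
      rw [abs_le]; constructor <;> linarith
    have g : ∀ X : ℝ, 1 ≤ Real.exp (3 * M) * X → 0 < X →
        C₂ ≤ (C₁ + C₂ * Real.exp (3 * M)) * X := by
      intro X h1 h2
      have := mul_le_mul_of_nonneg_left h1 hC₂0.le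
      have := mul_pos hC₁0 h2
      linarith
    refine ⟨c1.trans (g _ ?_ hX2), c2.trans (g _ ?_ hX3)⟩
    · rw [← Real.exp_add]; exact Real.one_le_exp (by linarith)
    · rw [← Real.exp_add]; exact Real.one_le_exp (by linarith)
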